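/- Let op_0 op_1 ... op_n be a valid sequence of order-2 stack operations and 0 ≤ j ≤ n with op_j = ⇓ (collapse). Then ℓ := push1(j−1) ≥ 0 and, with k := Push2(ℓ − 1), the entire annotated order-2 stack W_j equals W_{k−1}. -/

import Mathlib

/-- Order-2 stack operations over stack alphabet `S`. -/
inductive Op (S : Type) : Type where
  | push1 : S → Op S
  | pop1  : Op S
  | push2 : Op S
  | pop2  : Op S
  | collapse : Op S
  deriving DecidableEq

/-- Annotated stack symbol: (symbol, collapse link, position annotation). -/
abbrev ASym (S : Type) : Type := S × ℕ × ℤ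
/-- Annotated order-1 stack, topmost symbol first. -/
abbrev Stk1 (S : Type) : Type := List (ASym S)
/-- Annotated order-2 stack: list of (position annotation, order-1 stack), topmost first.
In `[[u_1][u_2] ⋯ [u_n]]` the topmost stack `u_n` comes first in the list. -/
abbrev Stk2 (S : Type) : Type := List (ℤ × Stk1 S)

/-- The initial order-2 stack `[[]]`, its unique (empty) order-1 stack annotated `-1`. -/
def initStk (S : Type) : Stk2 S := [(-1, ([] : Stk1 S))]

/-- One step of the annotated semantics; `p` is the current position.
`push1 s` records the collapse link `n-1` (number of stacks below the top) and the
position annotation `p`; `push2` duplicates the top stack annotating the copy with `p`;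
`collapse` keeps the bottom `i` order-1 stacks, where `i` is the collapse link of the
topmost symbol.  Undefined operations yield `none`. -/
def step {S : Type} (p : ℕ) (op : Op S) (W : Stk2 S) : Option (Stk2 S) :=
  match op, W with
  | .push2, t :: rest => some (((p : ℤ), t.2) :: t :: rest)
  | .pop2, _ :: t :: rest => some (t :: rest)
  | .push1 s, (a, u) :: rest => some ((a, (s, rest.length, (p : ℤ)) :: u) :: rest)
  | .pop1, (a, _ :: u) :: rest => some ((a, u) :: rest)
  | .collapse, (_, (_, i, _) :: _) :: _ =>
      if 1 ≤ i ∧ i < W.length then some (W.drop (W.length - i)) else none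
  | _, _ => none

def runFrom {S : Type} (p : ℕ) (W : Stk2 S) : List (Op S) → Option (Stk2 S)
  | [] => some W
  | op :: rest => (step p op W).bind fun W' => runFrom (p + 1) W' rest

/-- `stkAt ops j` is the annotated order-2 stack `W_j` after executing `op_0 ⋯ op_j`
(for `j = -1` this is the initial stack `[[]]`). -/
def stkAt {S : Type} (ops : List (Op S)) (j : ℤ) : Option (Stk2 S) :=
  runFrom 0 (initStk S) (ops.take (j + 1).toNat)

/-- A nonempty sequence of operations is valid if every operation is defined,
starting from the empty order-2 stack `[[]]`. -/
def Valid {S : Type} (ops : List (Op S)) : Prop :=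
  ops ≠ [] ∧ (runFrom 0 (initStk S) ops).isSome

/-- `push1At ops j` is `push1(j)`: the position annotation of the topmost symbol of the
topmost order-1 stack of `W_j`, or `-1` if that stack is empty (also `-1` for `j = -1`). -/
def push1At {S : Type} (ops : List (Op S)) (j : ℤ) : ℤ :=
  match stkAt ops j with
  | some ((_, (_, _, p) :: _) :: _) => p
  | _ => -1

/-- `Push2At ops j` is `Push2(j)`: the position annotation of the topmost order-1 stack
of `W_j` (`-1` for `j = -1`). -/
def Push2At {S : Type} (ops : List (Op S)) (j : ℤ) : ℤ :=
  match stkAt ops j with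
  | some ((a, _) :: _) => a
  | _ => -1


/-- Invariant of reachable annotated stacks, `H m` being the stack before position `m`. -/
def GoodStk {S : Type} (H : ℕ → Option (Stk2 S)) : Stk2 S → Prop
  | [] => True
  | t :: rest =>
      (rest ≠ [] → ∃ k : ℕ, t.1 = (k : ℤ) ∧ H k = some rest) ∧
      (∀ x ∈ t.2, ∃ l : ℕ, x.2.2 = (l : ℤ) ∧ ∃ b v r, H l = some ((b, v) :: r) ∧
        r.length = x.2.1 ∧ r <:+ rest) ∧
      GoodStk H rest

theorem GoodStk.drop {S : Type} {H : ℕ → Option (Stk2 S)} :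
    ∀ (n : ℕ) (W : Stk2 S), GoodStk H W → GoodStk H (W.drop n)
  | 0, W, h => by simpa using h
  | n + 1, [], h => by simpa using h
  | n + 1, t :: rest, h => by
      simpa using GoodStk.drop n rest h.2.2

theorem GoodStk.step {S : Type} {H : ℕ → Option (Stk2 S)} (p : ℕ) (op : Op S)
    (W W' : Stk2 S) (hW : H p = some W) (hs : step p op W = some W')
    (h : GoodStk H W) : GoodStk H W' := by
  unfold _root_.step at hs
  split at hs
  · rename_i t rest
    cases hs
    refine ⟨fun _ => ⟨p, rfl, hW⟩, ?_, h⟩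
    intro x hx
    obtain ⟨l, h1, b, v, r, h2, h3, h4⟩ := h.2.1 x hx
    exact ⟨l, h1, b, v, r, h2, h3, h4.trans (List.suffix_cons _ _)⟩
  · cases hs
    exact h.2.2
  · rename_i s a u rest
    cases hs
    refine ⟨h.1, ?_, h.2.2⟩
    intro x hx
    rcases List.mem_cons.1 hx with rfl | hx
    · exact ⟨p, rfl, a, u, rest, hW, rfl, List.suffix_rfl⟩
    · exact h.2.1 x hx
  · cases hs
    exact ⟨h.1, fun x hx => h.2.1 x (List.mem_cons_of_mem _ hx), h.2.2⟩
  · split at hs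
    · cases hs
      exact h.drop _ _
    · cases hs
  · cases hs

theorem runFrom_append {S : Type} (a b : List (Op S)) : ∀ (p : ℕ) (W : Stk2 S),
    runFrom p W (a ++ b) = (runFrom p W a).bind fun W' => runFrom (p + a.length) W' b := by
  induction a with
  | nil => intro p W; simp [runFrom]
  | cons o a ih =>
    intro p W
    simp only [List.cons_append, runFrom, List.length_cons]
    cases step p o W with
    | none => rfl
    | some V =>
      simp only [Option.bind_some]
      rw [ih, Nat.add_assoc, Nat.add_comm 1]

/-- The stack before position `m`. -/
def before {S : Type} (ops : List (Op S)) (m : ℕ) : Option (Stk2 S) :=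
  runFrom 0 (initStk S) (ops.take m)

theorem before_succ {S : Type} (ops : List (Op S)) (m : ℕ) (o : Op S)
    (h : ops[m]? = some o) :
    before ops (m + 1) = (before ops m).bind (step m o) := by
  obtain ⟨hm, h'⟩ := List.getElem?_eq_some_iff.1 h
  unfold before
  rw [List.take_add_one, h, runFrom_append]
  have : min m ops.length = m := by omega
  simp [runFrom, this]

theorem before_good {S : Type} (ops : List (Op S)) (m : ℕ) :
    ∀ W, before ops m = some W → GoodStk (before ops) W := by
  induction m with
  | zero =>
    intro W h
    simp only [before, List.take_zero, runFrom, initStk, Option.some.injEq] at h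
    subst h
    simp [GoodStk]
  | succ m ih =>
    intro W h
    cases ho : ops[m]? with
    | none =>
      apply ih
      rw [← h]
      unfold before
      rw [List.take_add_one, ho]
      simp
    | some o =>
      rw [before_succ ops m o ho] at h
      obtain ⟨V, hV, hs⟩ := Option.bind_eq_some_iff.1 h
      exact GoodStk.step m o V W hV hs (ih V hV)

theorem stkAt_pred {S : Type} (ops : List (Op S)) (m : ℕ) :
    stkAt ops ((m : ℤ) - 1) = before ops m := by
  simp [stkAt, before]

/-- In a valid sequence, if `op_j = ⇓` then `ℓ := push1(j-1) ≥ 0` and,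
with `k := Push2(ℓ - 1)`, the entire annotated order-2 stack `W_j` equals `W_{k-1}`. -/
theorem collapse_stack_eq {S : Type} (ops : List (Op S)) (hv : Valid ops)
    (j : ℕ) (hj : j < ops.length) (hop : ops[j]? = some Op.collapse) :
    0 ≤ push1At ops ((j : ℤ) - 1) ∧
    ∃ W : Stk2 S,
      stkAt ops (j : ℤ) = some W ∧
      stkAt ops (Push2At ops (push1At ops ((j : ℤ) - 1) - 1) - 1) = some W := by
  have hsome : ∃ W, before ops (j + 1) = some W := by
    have h2 := hv.2
    rw [← List.take_append_drop (j + 1) ops, runFrom_append] at h2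
    unfold before
    cases h : runFrom 0 (initStk S) (ops.take (j + 1)) with
    | none => rw [h] at h2; simp at h2
    | some W => exact ⟨W, rfl⟩
  obtain ⟨W, hW⟩ := hsome
  have hWj : stkAt ops (j : ℤ) = some W := by
    rw [← hW, ← stkAt_pred]; simp
  rw [before_succ ops j _ hop] at hW
  obtain ⟨V, hV, hs⟩ := Option.bind_eq_some_iff.1 hW
  have hg := before_good ops j V hV
  rcases V with _ | ⟨⟨a, _ | ⟨⟨s, i, q⟩, u⟩⟩, rest⟩
  · simp [step] at hs
  · simp [step] at hs
  simp only [step] at hs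
  split at hs
  swap
  · cases hs
  rename_i hi
  obtain ⟨l, hl, b, v, r, h2, h3, h4⟩ := hg.2.1 (s, i, q) (by simp)
  simp only at hl h3
  subst hl
  have hp : push1At ops ((j : ℤ) - 1) = (l : ℤ) := by
    simp [push1At, stkAt_pred, hV]
  have hg2 := before_good ops l _ h2
  have hr : r ≠ [] := by
    rintro rfl
    simp at h3
    omega
  obtain ⟨k, hk, hk2⟩ := hg2.1 hr
  simp only at hk
  have hP : Push2At ops ((l : ℤ) - 1) = (k : ℤ) := by
    simp [Push2At, stkAt_pred, h2, hk]
  rw [hp, hP, stkAt_pred, hk2]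
  refine ⟨by positivity, W, hWj, ?_⟩
  rw [← hs]
  have h5 := List.suffix_iff_eq_drop.1
    (h4.trans (List.suffix_cons (a, (s, i, (l : ℤ)) :: u) rest))
  rw [h3] at h5
  rw [← h5]
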